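/- arXiv:0712.4377 — 6 statements merged into one kernel-verified Lean document; each statement's English description precedes it below -/
import Mathlib

section
/- Quantum counting argument. Let d, D ≥ 1 be natural numbers and let δ be a real number with 0 ≤ δ < 1/(2e). Let E : M_d(ℂ) → M_D(ℂ) be a quantum operation (a linear, completely positive, trace-preserving map). Suppose ψ_1, …, ψ_N is an orthonormal family of vectors in ℂ^D such that for every j ∈ {1,…,N} there exists a density matrix σ_j ∈ M_d(ℂ) whose image satisfies ½‖E(σ_j) − P_{ψ_j}‖₁ ≤ δ. Then, provided N ≥ 1, log₂ N ≤ (log₂ d + 4δ·log₂(1/δ)) / (1 − 4δ), with the convention 0·log₂(1/0) := 0 in the case δ = 0. -/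
open Matrix
open scoped ComplexOrder

open scoped MatrixOrder in
/-- The trace norm `Tr |A|` of a square complex matrix, where `|A|` is the positive
semidefinite square root of `Aᴴ * A`. -/
noncomputable def traceNorm {n : ℕ} (A : Matrix (Fin n) (Fin n) ℂ) : ℝ :=
  (CFC.sqrt (Aᴴ * A)).trace.re

/-- Trace distance: half the trace norm of the difference. -/
noncomputable def traceDist {n : ℕ} (A B : Matrix (Fin n) (Fin n) ℂ) : ℝ :=
  traceNorm (A - B) / 2

/-- A density matrix: positive semidefinite with trace one. -/
def IsDensityMatrix {n : ℕ} (ρ : Matrix (Fin n) (Fin n) ℂ) : Prop :=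
  ρ.PosSemidef ∧ ρ.trace = 1

/-- The rank-one (outer product) matrix `|ψ⟩⟨ψ|` of a vector. -/
noncomputable def projOf {n : ℕ} (ψ : Fin n → ℂ) : Matrix (Fin n) (Fin n) ℂ :=
  Matrix.vecMulVec ψ (star ψ)

/-- Trace preservation for a linear map between matrix algebras. -/
def IsTracePreserving {d D : ℕ}
    (E : Matrix (Fin d) (Fin d) ℂ →ₗ[ℂ] Matrix (Fin D) (Fin D) ℂ) : Prop :=
  ∀ A, (E A).trace = A.trace

/-- Complete positivity: for every `k`, the map `id_k ⊗ E` on block matrices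
preserves positive semidefiniteness. -/
def IsCompletelyPositive {d D : ℕ}
    (E : Matrix (Fin d) (Fin d) ℂ →ₗ[ℂ] Matrix (Fin D) (Fin D) ℂ) : Prop :=
  ∀ (k : ℕ) (A : Matrix (Fin k × Fin d) (Fin k × Fin d) ℂ), A.PosSemidef →
    (Matrix.of fun p q : Fin k × Fin D =>
      E (Matrix.of fun a b => A (p.1, a) (q.1, b)) p.2 q.2).PosSemidef

/-- Compressing a positive semidefinite matrix along an isometry does not increase the trace. -/
lemma Matrix.PosSemidef.trace_conjTranspose_mul_mul_le {m n : Type*} [Fintype m] [Fintype n]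
    [DecidableEq m] [DecidableEq n] {M : Matrix m m ℂ} (hM : M.PosSemidef)
    {V : Matrix m n ℂ} (hV : Vᴴ * V = 1) : (Vᴴ * M * V).trace ≤ M.trace := by
  have h := (hM.mul_mul_conjTranspose_same (1 - V * Vᴴ)).trace_nonneg
  have hQ : (1 - V * Vᴴ)ᴴ * (1 - V * Vᴴ) = 1 - V * Vᴴ := by
    have h2 : V * Vᴴ * (V * Vᴴ) = V * Vᴴ := by
      rw [Matrix.mul_assoc, ← Matrix.mul_assoc Vᴴ, hV, Matrix.one_mul]
    simp [Matrix.sub_mul, Matrix.mul_sub, h2]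
  rw [Matrix.trace_mul_comm, ← Matrix.mul_assoc, hQ, Matrix.sub_mul, Matrix.trace_sub,
    Matrix.one_mul, Matrix.mul_assoc, Matrix.trace_mul_comm V] at h
  exact sub_nonneg.mp h

/-- The diagonal entries of a positive semidefinite matrix along an orthonormal family sum to at
most its trace. -/
lemma Matrix.PosSemidef.sum_dotProduct_mulVec_le {m n : Type*} [Fintype m] [Fintype n]
    [DecidableEq m] [DecidableEq n] {M : Matrix m m ℂ} (hM : M.PosSemidef) {ψ : n → m → ℂ}
    (hψ : ∀ i j, star (ψ i) ⬝ᵥ ψ j = if i = j then 1 else 0) :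
    ∑ j, star (ψ j) ⬝ᵥ M *ᵥ ψ j ≤ M.trace := by
  have hV : ((Matrix.of ψ)ᵀ)ᴴ * (Matrix.of ψ)ᵀ = 1 := by
    ext i j
    simpa [Matrix.mul_apply, dotProduct, Matrix.one_apply] using hψ i j
  convert hM.trace_conjTranspose_mul_mul_le hV using 1
  refine Finset.sum_congr rfl fun j _ => ?_
  rw [Matrix.mul_assoc]
  simp [Matrix.mul_apply, dotProduct, Matrix.mulVec]

lemma Matrix.PosSemidef.dotProduct_mulVec_le {m : Type*} [Fintype m] [DecidableEq m]
    {M : Matrix m m ℂ} (hM : M.PosSemidef) {x : m → ℂ} (hx : star x ⬝ᵥ x = 1) :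
    star x ⬝ᵥ M *ᵥ x ≤ M.trace := by
  simpa using hM.sum_dotProduct_mulVec_le (ψ := fun _ : Unit => x) fun _ _ => by simpa using hx

/-- A density matrix is bounded above by the identity. -/
lemma IsDensityMatrix.posSemidef_one_sub {n : ℕ} {σ : Matrix (Fin n) (Fin n) ℂ}
    (hσ : IsDensityMatrix σ) : (1 - σ).PosSemidef := by
  refine Matrix.PosSemidef.of_dotProduct_mulVec_nonneg
    (Matrix.isHermitian_one.sub hσ.1.isHermitian) fun x => ?_
  rcases eq_or_ne x 0 with rfl | hx
  · simp
  obtain ⟨c, hc, hcx⟩ : ∃ c : ℝ, 0 < c ∧ star x ⬝ᵥ x = c := by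
    have h := Matrix.dotProduct_star_self_pos_iff.mpr hx
    obtain ⟨h1, h2⟩ := Complex.pos_iff.mp h
    exact ⟨_, h1, Complex.ext rfl (by simpa using h2.symm)⟩
  have hs : ((√c : ℝ) : ℂ) * (√c : ℝ) = c := by
    rw [← Complex.ofReal_mul, Real.mul_self_sqrt hc.le]
  have hs0 : ((√c : ℝ) : ℂ) ≠ 0 := by
    simpa using (Real.sqrt_pos.mpr hc).ne'
  obtain ⟨y, rfl⟩ : ∃ y, x = ((√c : ℝ) : ℂ) • y := ⟨((√c : ℝ) : ℂ)⁻¹ • x, by simp [hs0]⟩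
  have hc0 : (c : ℂ) ≠ 0 := by exact_mod_cast hc.ne'
  simp only [star_smul, smul_dotProduct, dotProduct_smul, Matrix.mulVec_smul, smul_eq_mul,
    RCLike.star_def, Complex.conj_ofReal, ← mul_assoc, hs] at hcx ⊢
  have hy : star y ⬝ᵥ y = 1 := mul_left_cancel₀ hc0 (by rw [hcx, mul_one])
  have h := hσ.1.dotProduct_mulVec_le hy
  rw [hσ.2] at h
  refine mul_nonneg (by exact_mod_cast hc.le) ?_
  rw [Matrix.sub_mulVec, dotProduct_sub, Matrix.one_mulVec, hy]
  exact sub_nonneg.mpr h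

open scoped MatrixOrder Matrix.Norms.L2Operator in
/-- The quadratic form of a Hermitian matrix at a unit vector is at least minus the trace norm. -/
lemma Matrix.IsHermitian.neg_traceNorm_le {n : ℕ} {A : Matrix (Fin n) (Fin n) ℂ}
    (hA : A.IsHermitian) {x : Fin n → ℂ} (hx : star x ⬝ᵥ x = 1) :
    -traceNorm A ≤ (star x ⬝ᵥ A *ᵥ x).re := by
  have habs : CFC.sqrt (Aᴴ * A) = CFC.abs A := rfl
  have hsum : (CFC.abs A + A).PosSemidef := by
    rw [CFC.abs_add_self A hA.isSelfAdjoint, ← Matrix.nonneg_iff_posSemidef]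
    exact smul_nonneg zero_le_two (CFC.posPart_nonneg A)
  have h1 := (Complex.le_def.mp (hsum.dotProduct_mulVec_nonneg x)).1
  have h2 := (Complex.le_def.mp ((Matrix.nonneg_iff_posSemidef.mp
    (CFC.abs_nonneg A)).dotProduct_mulVec_le hx)).1
  rw [Matrix.add_mulVec, dotProduct_add, Complex.add_re, Complex.zero_re] at h1
  rw [traceNorm, habs]
  linarith

/-- A completely positive map is positive. -/
lemma IsCompletelyPositive.map_posSemidef {d D : ℕ}
    {E : Matrix (Fin d) (Fin d) ℂ →ₗ[ℂ] Matrix (Fin D) (Fin D) ℂ}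
    (hE : IsCompletelyPositive E) {A : Matrix (Fin d) (Fin d) ℂ} (hA : A.PosSemidef) :
    (E A).PosSemidef :=
  (hE 1 _ (hA.submatrix Prod.snd)).submatrix fun a => ((0 : Fin 1), a)

lemma dotProduct_projOf_mulVec {n : ℕ} {x : Fin n → ℂ} (hx : star x ⬝ᵥ x = 1) :
    star x ⬝ᵥ projOf x *ᵥ x = 1 := by
  simp [projOf, Matrix.vecMulVec_mulVec, hx]

/-- A quantum operation on `M_d(ℂ)` whose outputs approximate `N` orthonormal pure states up to
trace distance `δ` satisfies `N (1 - 2δ) ≤ d`. -/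
lemma card_mul_one_sub_le {d D N : ℕ} {δ : ℝ}
    {E : Matrix (Fin d) (Fin d) ℂ →ₗ[ℂ] Matrix (Fin D) (Fin D) ℂ}
    (hCP : IsCompletelyPositive E) (hTP : IsTracePreserving E)
    {ψ : Fin N → Fin D → ℂ}
    (hortho : ∀ i j, star (ψ i) ⬝ᵥ ψ j = if i = j then 1 else 0)
    (happrox : ∀ j, ∃ σ : Matrix (Fin d) (Fin d) ℂ,
      IsDensityMatrix σ ∧ traceDist (E σ) (projOf (ψ j)) ≤ δ) :
    N * (1 - 2 * δ) ≤ d := by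
  have hE1 := (Complex.le_def.mp
    ((hCP.map_posSemidef Matrix.PosSemidef.one).sum_dotProduct_mulVec_le hortho)).1
  rw [hTP, Matrix.trace_one, Complex.re_sum] at hE1
  have hterm : ∀ j, 1 - 2 * δ ≤ (star (ψ j) ⬝ᵥ E 1 *ᵥ ψ j).re := by
    intro j
    obtain ⟨σ, hσ, hdist⟩ := happrox j
    have hψ : star (ψ j) ⬝ᵥ ψ j = 1 := by simpa using hortho j j
    have hP : (projOf (ψ j)).IsHermitian := (Matrix.posSemidef_vecMulVec_self_star _).isHermitian
    have h1 := ((hCP.map_posSemidef hσ.1).isHermitian.sub hP).neg_traceNorm_le hψ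
    have h2 := (Complex.le_def.mp
      ((hCP.map_posSemidef hσ.posSemidef_one_sub).dotProduct_mulVec_nonneg (ψ j))).1
    rw [Matrix.sub_mulVec, dotProduct_sub, dotProduct_projOf_mulVec hψ, Complex.sub_re,
      Complex.one_re] at h1
    rw [map_sub, Matrix.sub_mulVec, dotProduct_sub, Complex.sub_re, Complex.zero_re] at h2
    rw [traceDist] at hdist
    linarith
  have hsum := Finset.sum_le_sum fun j (_ : j ∈ Finset.univ) => hterm j
  simp only [Finset.sum_const, Finset.card_univ, Fintype.card_fin, nsmul_eq_mul,
    Complex.natCast_re] at hsum hE1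
  exact hsum.trans hE1

/-- **Quantum counting argument.** If `E : M_d(ℂ) → M_D(ℂ)` is a quantum operation
and `ψ_1, …, ψ_N` is an orthonormal family such that each `P_{ψ_j}` is within trace
distance `δ < 1/(2e)` of the image of some density matrix, then
`log₂ N ≤ (log₂ d + 4δ log₂(1/δ)) / (1 − 4δ)`. -/
theorem quantum_counting_argument
    (d D N : ℕ) (hd : 1 ≤ d) (hD : 1 ≤ D) (hN : 1 ≤ N)
    (δ : ℝ) (hδ0 : 0 ≤ δ) (hδ1 : δ < 1 / (2 * Real.exp 1))
    (E : Matrix (Fin d) (Fin d) ℂ →ₗ[ℂ] Matrix (Fin D) (Fin D) ℂ)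
    (hCP : IsCompletelyPositive E) (hTP : IsTracePreserving E)
    (ψ : Fin N → Fin D → ℂ)
    (hortho : ∀ i j, star (ψ i) ⬝ᵥ ψ j = if i = j then 1 else 0)
    (happrox : ∀ j, ∃ σ : Matrix (Fin d) (Fin d) ℂ,
      IsDensityMatrix σ ∧ traceDist (E σ) (projOf (ψ j)) ≤ δ) :
    Real.logb 2 N ≤ (Real.logb 2 d + 4 * δ * Real.logb 2 (1 / δ)) / (1 - 4 * δ) := by
  have hδ : 2 * Real.exp 1 * δ < 1 := by
    rw [lt_div_iff₀ (by positivity)] at hδ1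
    linarith
  have hexp : (2.7 : ℝ) < Real.exp 1 := by linarith [Real.exp_one_gt_d9]
  have hδ4 : 4 * δ < 1 := by nlinarith
  have hN0 : (0 : ℝ) < N := by exact_mod_cast hN
  have hlogd : 0 ≤ Real.log d := Real.log_nonneg (by exact_mod_cast hd)
  have hlogN : Real.log N + Real.log (1 - 2 * δ) ≤ Real.log d := by
    have h2δ : 0 < 1 - 2 * δ := by linarith
    rw [← Real.log_mul hN0.ne' h2δ.ne']
    exact Real.log_le_log (by positivity) (card_mul_one_sub_le hCP hTP hortho happrox)
  have hlogδ : δ ≤ δ * Real.log (1 / δ) := by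
    rcases hδ0.eq_or_lt with rfl | hpos
    · simp
    · refine le_mul_of_one_le_right hδ0 ((Real.le_log_iff_exp_le (by positivity)).mpr ?_)
      rw [le_div_iff₀ hpos]
      nlinarith
  have hlog : -(2 * δ) ≤ (1 - 2 * δ) * Real.log (1 - 2 * δ) := by
    have h2δ : 0 < 1 - 2 * δ := by linarith
    have h := mul_le_mul_of_nonneg_left (Real.one_sub_inv_le_log_of_pos h2δ) h2δ.le
    rw [mul_sub, mul_inv_cancel₀ h2δ.ne'] at h
    linarith
  have hlog_nonpos : Real.log (1 - 2 * δ) ≤ 0 := Real.log_nonpos (by linarith) (by linarith)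
  have key : Real.log N * (1 - 4 * δ) ≤ Real.log d + 4 * δ * Real.log (1 / δ) := by
    nlinarith [mul_le_mul_of_nonneg_right hlogN (by linarith : 0 ≤ 1 - 4 * δ),
      mul_nonneg hδ0 hlogd, mul_nonneg hδ0 (neg_nonneg.mpr hlog_nonpos)]
  rw [le_div_iff₀ (by linarith)]
  simp only [Real.logb]
  have hlog2 : 0 < Real.log 2 := Real.log_pos one_lt_two
  calc Real.log N / Real.log 2 * (1 - 4 * δ) = Real.log N * (1 - 4 * δ) / Real.log 2 := by ring
    _ ≤ (Real.log d + 4 * δ * Real.log (1 / δ)) / Real.log 2 := by gcongr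
    _ = _ := by ring
end

section
/- Halting subspaces are mutually orthogonal linear subspaces. Let H and H' be complex Hilbert spaces, ι : H → H' a linear isometry, U a unitary operator on H', and P an orthogonal projection on H'. For each t ∈ ℕ define H(t) := { x ∈ H : P(U^t(ι x)) = U^t(ι x), and P(U^{t'}(ι x)) = 0 for every t' < t }. Then each H(t) is a linear subspace of H, and for t ≠ t' the subspaces H(t) and H(t') are mutually orthogonal, i.e. ⟨x, y⟩ = 0 whenever x ∈ H(t) and y ∈ H(t'). -/
/-- Powers of a norm-preserving operator preserve inner products. -/
theorem inner_pow_apply_of_norm_map {E : Type*} [NormedAddCommGroup E] [InnerProductSpace ℂ E]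
    {U : E →L[ℂ] E} (hU : ∀ x, ‖U x‖ = ‖x‖) (n : ℕ) (x y : E) :
    (inner ℂ ((U ^ n) x) ((U ^ n) y) : ℂ) = inner ℂ x y := by
  induction n with
  | zero => simp
  | succ n ih =>
    rw [pow_succ', mul_apply_eq_comp, mul_apply_eq_comp, ← ih]
    exact LinearIsometry.inner_map_map ⟨U.toLinearMap, hU⟩ _ _

/-- The subspace of inputs halting exactly at time `t`. -/
def haltingSubspace {H H' : Type*} [NormedAddCommGroup H] [InnerProductSpace ℂ H]
    [NormedAddCommGroup H'] [InnerProductSpace ℂ H']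
    (ι : H →ₗᵢ[ℂ] H') (U P : H' →L[ℂ] H') (t : ℕ) : Submodule ℂ H where
  carrier := {x : H | P ((U ^ t) (ι x)) = (U ^ t) (ι x) ∧ ∀ t' < t, P ((U ^ t') (ι x)) = 0}
  add_mem' := by
    rintro x y ⟨hx, hx'⟩ ⟨hy, hy'⟩
    refine ⟨by simp only [map_add, hx, hy], fun t' ht' => ?_⟩
    simp only [map_add, hx' t' ht', hy' t' ht', add_zero]
  zero_mem' := by simp
  smul_mem' := by
    rintro c x ⟨hx, hx'⟩
    refine ⟨by simp only [map_smul, hx], fun t' ht' => ?_⟩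
    simp only [map_smul, hx' t' ht', smul_zero]

/-- Inputs halting at different times are orthogonal. -/
theorem inner_eq_zero_of_mem_haltingSubspace_of_lt
    {H H' : Type*} [NormedAddCommGroup H] [InnerProductSpace ℂ H]
    [NormedAddCommGroup H'] [InnerProductSpace ℂ H']
    {ι : H →ₗᵢ[ℂ] H'} {U P : H' →L[ℂ] H'} (hU : ∀ x, ‖U x‖ = ‖x‖)
    (hP : ∀ x y : H', (inner ℂ (P x) y : ℂ) = inner ℂ x (P y)) {t t' : ℕ} (h : t < t')
    {x y : H} (hx : x ∈ haltingSubspace ι U P t) (hy : y ∈ haltingSubspace ι U P t') :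
    (inner ℂ x y : ℂ) = 0 := by
  rw [← ι.inner_map_map, ← inner_pow_apply_of_norm_map hU t, ← hx.1, hP, hy.2 t h,
    inner_zero_right]

/-- **Halting subspaces are mutually orthogonal linear subspaces.**
In the abstract QTM setting (a linear isometry `ι : H → H'` embedding inputs,
a unitary `U` on `H'` as one time step, and an orthogonal projection `P` onto the
halting configurations), for each `t` the set of inputs halting exactly at time `t`
is a linear subspace of `H`, and these subspaces are mutually orthogonal. -/
theorem halting_subspaces
    {H H' : Type*} [NormedAddCommGroup H] [InnerProductSpace ℂ H]
    [NormedAddCommGroup H'] [InnerProductSpace ℂ H']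
    (ι : H →ₗᵢ[ℂ] H') (U : H' →L[ℂ] H')
    (hUiso : ∀ x : H', ‖U x‖ = ‖x‖) (hUsurj : Function.Surjective U)
    (P : H' →L[ℂ] H')
    (hPsa : ∀ x y : H', (inner ℂ (P x) y : ℂ) = inner ℂ x (P y))
    (hPidem : ∀ x : H', P (P x) = P x) :
    ∃ V : ℕ → Submodule ℂ H,
      (∀ t : ℕ, (V t : Set H) =
        {x : H | P ((U ^ t) (ι x)) = (U ^ t) (ι x) ∧
          ∀ t' < t, P ((U ^ t') (ι x)) = 0}) ∧
      (∀ t t' : ℕ, t ≠ t' → ∀ x ∈ V t, ∀ y ∈ V t', (inner ℂ x y : ℂ) = 0) := by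
  refine ⟨haltingSubspace ι U P, fun _ => rfl, fun t t' hne x hx y hy => ?_⟩
  rcases hne.lt_or_gt with h | h
  · exact inner_eq_zero_of_mem_haltingSubspace_of_lt hUiso hPsa h hx hy
  · exact inner_eq_zero_symm.mp (inner_eq_zero_of_mem_haltingSubspace_of_lt hUiso hPsa h hy hx)
end

section
/- Almost-orthogonality of approximately halting inputs with different halting times. Let H and H' be complex Hilbert spaces, ι : H → H' a linear isometry, U a unitary operator on H', and P an orthogonal projection on H'. Let ε, δ ≥ 0 with ε + δ ≤ 1, and let t ≠ t' be natural numbers. If φ ∈ H is a unit vector that is ε-t-halting and ψ ∈ H is a unit vector that is δ-t'-halting, then |⟨ψ, φ⟩| ≤ √(1 − (1 − ε − δ)²). -/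
/-- If an orthogonal projection `P` acts on unit vectors `a`, `b` with `‖P a‖²` and `‖P b‖²` at
least `c ≥ 0` apart, then `|⟨b, a⟩| ≤ √(1 - c²)`. -/
theorem norm_inner_le_sqrt_of_projection_gap
    {E : Type*} [NormedAddCommGroup E] [InnerProductSpace ℂ E] (P : E →L[ℂ] E)
    (hPsa : ∀ x y : E, (inner ℂ (P x) y : ℂ) = inner ℂ x (P y))
    (hPidem : ∀ x : E, P (P x) = P x) {a b : E} (ha : ‖a‖ = 1) (hb : ‖b‖ = 1)
    {c : ℝ} (hc : 0 ≤ c) (hgap : c ≤ ‖P a‖ ^ 2 - ‖P b‖ ^ 2) :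
    ‖(inner ℂ b a : ℂ)‖ ≤ Real.sqrt (1 - c ^ 2) := by
  have inner_split (x y : E) :
      (inner ℂ x y : ℂ) = inner ℂ (P x) (P y) + inner ℂ (x - P x) (y - P y) := by
    have h₁ : (inner ℂ (P x) (P y) : ℂ) = inner ℂ x (P y) := by rw [hPsa, hPidem]
    simp only [inner_sub_left, inner_sub_right, h₁, hPsa x y]
    ring
  have norm_split (x : E) : ‖x‖ ^ 2 = ‖P x‖ ^ 2 + ‖x - P x‖ ^ 2 := by
    have h := inner_split x x
    simp only [inner_self_eq_norm_sq_to_K] at h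
    exact_mod_cast h
  have hle : ‖(inner ℂ b a : ℂ)‖ ≤ ‖P b‖ * ‖P a‖ + ‖b - P b‖ * ‖a - P a‖ := by
    rw [inner_split b a]
    exact (norm_add_le _ _).trans (add_le_add (norm_inner_le_norm _ _) (norm_inner_le_norm _ _))
  have hsa := norm_split a
  have hsb := norm_split b
  rw [ha] at hsa
  rw [hb] at hsb
  generalize ‖P a‖ = x at *
  generalize ‖P b‖ = u at *
  generalize ‖a - P a‖ = y at *
  generalize ‖b - P b‖ = v at *
  have hcos : (u * x + v * y) ^ 2 = 1 - (x * v - y * u) ^ 2 := by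
    linear_combination -(x ^ 2 + y ^ 2) * hsb - hsa
  have hfac : x ^ 2 - u ^ 2 = (x * v - y * u) * (x * v + y * u) := by
    linear_combination x ^ 2 * hsb - u ^ 2 * hsa
  have hsin : (x * v + y * u) ^ 2 = 1 - (x * u - y * v) ^ 2 := by
    linear_combination -(x ^ 2 + y ^ 2) * hsb - hsa
  have hsin_le : (x * v + y * u) ^ 2 ≤ 1 := by
    linarith [sq_nonneg (x * u - y * v)]
  have hc_sq : c ^ 2 ≤ (x * v - y * u) ^ 2 := calc
    c ^ 2 ≤ (x ^ 2 - u ^ 2) ^ 2 := pow_le_pow_left₀ hc hgap 2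
    _ = (x * v - y * u) ^ 2 * (x * v + y * u) ^ 2 := by rw [hfac, mul_pow]
    _ ≤ (x * v - y * u) ^ 2 := mul_le_of_le_one_right (sq_nonneg _) hsin_le
  refine hle.trans (Real.le_sqrt_of_sq_le ?_)
  linarith

/-- **Almost-orthogonality of approximately halting inputs with different halting
times.** In the abstract QTM setting (a linear isometry `ι : H → H'`, a unitary `U`
on `H'`, and an orthogonal projection `P`), a unit vector `x` is `ε`-`t`-halting if
`‖P(U^{t'}(ι x))‖² ≤ ε` for all `t' < t` and `‖P(U^t(ι x))‖² ≥ 1 − ε`.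
If `φ` is `ε`-`t`-halting and `ψ` is `δ`-`t'`-halting with `t ≠ t'` and `ε + δ ≤ 1`,
then `|⟨ψ, φ⟩| ≤ √(1 − (1 − ε − δ)²)`. -/
theorem almost_orthogonality_of_approx_halting
    {H H' : Type*} [NormedAddCommGroup H] [InnerProductSpace ℂ H]
    [NormedAddCommGroup H'] [InnerProductSpace ℂ H']
    (ι : H →ₗᵢ[ℂ] H') (U : H' →L[ℂ] H')
    (hUiso : ∀ x : H', ‖U x‖ = ‖x‖) (hUsurj : Function.Surjective U)
    (P : H' →L[ℂ] H')
    (hPsa : ∀ x y : H', (inner ℂ (P x) y : ℂ) = inner ℂ x (P y))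
    (hPidem : ∀ x : H', P (P x) = P x)
    (ε δ : ℝ) (hε : 0 ≤ ε) (hδ : 0 ≤ δ) (hεδ : ε + δ ≤ 1)
    (t t' : ℕ) (htt' : t ≠ t')
    (φ ψ : H) (hφ : ‖φ‖ = 1) (hψ : ‖ψ‖ = 1)
    (hφhalt : (∀ s < t, ‖P ((U ^ s) (ι φ))‖ ^ 2 ≤ ε) ∧
      1 - ε ≤ ‖P ((U ^ t) (ι φ))‖ ^ 2)
    (hψhalt : (∀ s < t', ‖P ((U ^ s) (ι ψ))‖ ^ 2 ≤ δ) ∧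
      1 - δ ≤ ‖P ((U ^ t') (ι ψ))‖ ^ 2) :
    ‖(inner ℂ ψ φ : ℂ)‖ ≤ Real.sqrt (1 - (1 - ε - δ) ^ 2) := by
  let V : H' →ₗᵢ[ℂ] H' := ⟨U, hUiso⟩
  have hpow (n : ℕ) (x : H') : (U ^ n) x = (V ^ n) x := by
    induction n with
    | zero => rfl
    | succ n ih =>
      rw [pow_succ', pow_succ', mul_apply_eq_comp, ih]
      rfl
  have hnorm (n : ℕ) (x : H) : ‖(U ^ n) (ι x)‖ = ‖x‖ := by
    rw [hpow, LinearIsometry.norm_map, LinearIsometry.norm_map]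
  have hinner (n : ℕ) (x y : H) :
      (inner ℂ ((U ^ n) (ι x)) ((U ^ n) (ι y)) : ℂ) = inner ℂ x y := by
    rw [hpow, hpow, LinearIsometry.inner_map_map, LinearIsometry.inner_map_map]
  have hc : 0 ≤ 1 - ε - δ := by linarith
  rcases lt_or_gt_of_ne htt' with h | h
  · rw [← hinner t]
    refine norm_inner_le_sqrt_of_projection_gap P hPsa hPidem
      ((hnorm t φ).trans hφ) ((hnorm t ψ).trans hψ) hc ?_
    linarith [hφhalt.2, hψhalt.1 t h]
  · rw [norm_inner_symm, ← hinner t']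
    refine norm_inner_le_sqrt_of_projection_gap P hPsa hPidem
      ((hnorm t' ψ).trans hψ) ((hnorm t' φ).trans hφ) hc ?_
    linarith [hψhalt.2, hφhalt.1 t' h]
end

section
/- Approximate halting of superpositions. Let H and H' be complex Hilbert spaces, ι : H → H' a linear isometry, U a unitary operator on H', and P an orthogonal projection on H'. Let t ∈ ℕ, let ε_1, …, ε_N ≥ 0, and let x_1, …, x_N be unit vectors in H such that each x_i is ε_i-t-halting. If α_1, …, α_N ∈ ℂ are such that x := ∑_{i=1}^N α_i x_i is a unit vector, then x is ε-t-halting with ε := (∑_{i=1}^N |α_i|·√(ε_i))². -/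
/-- Pythagoras for a symmetric idempotent `P`. -/
theorem norm_sq_add_norm_sub_sq_of_symmetric_idempotent
    {E : Type*} [NormedAddCommGroup E] [InnerProductSpace ℂ E] (P : E →L[ℂ] E)
    (hPsa : ∀ x y : E, (inner ℂ (P x) y : ℂ) = inner ℂ x (P y))
    (hPidem : ∀ x : E, P (P x) = P x) (y : E) :
    ‖P y‖ ^ 2 + ‖y - P y‖ ^ 2 = ‖y‖ ^ 2 := by
  have horth : inner ℂ (P y) (y - P y) = 0 := by
    rw [hPsa, map_sub, hPidem, sub_self, inner_zero_right]
  have h := norm_add_sq_eq_norm_sq_add_norm_sq_of_inner_eq_zero (P y) (y - P y) horth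
  rw [add_sub_cancel] at h
  linarith

/-- A linear map with `‖A (x i)‖ ^ 2 ≤ ε i` sends `∑ α i • x i` to a vector of squared norm at
most `(∑ ‖α i‖ * √(ε i)) ^ 2`. -/
theorem norm_sq_map_sum_smul_le {κ E F : Type*} [Fintype κ]
    [NormedAddCommGroup E] [NormedSpace ℂ E] [NormedAddCommGroup F] [NormedSpace ℂ F]
    (A : E →ₗ[ℂ] F) (ε : κ → ℝ) (x : κ → E) (hx : ∀ i, ‖A (x i)‖ ^ 2 ≤ ε i) (α : κ → ℂ) :
    ‖A (∑ i, α i • x i)‖ ^ 2 ≤ (∑ i, ‖α i‖ * Real.sqrt (ε i)) ^ 2 := by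
  gcongr
  rw [map_sum]
  refine norm_sum_le_of_le _ fun i _ => ?_
  rw [map_smul, norm_smul]
  gcongr
  exact Real.le_sqrt_of_sq_le (hx i)

/-- **Approximate halting of superpositions.** In the abstract QTM setting (a linear
isometry `ι : H → H'`, a unitary `U` on `H'`, and an orthogonal projection `P`), a
unit vector `x` is `ε`-`t`-halting if `‖P(U^{t'}(ι x))‖² ≤ ε` for all `t' < t` and
`‖P(U^t(ι x))‖² ≥ 1 − ε`. If each unit vector `x_i` is `ε_i`-`t`-halting and
`x = ∑ α_i x_i` is a unit vector, then `x` is `(∑ |α_i| √ε_i)²`-`t`-halting. -/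
theorem approx_halting_of_superpositions
    {H H' : Type*} [NormedAddCommGroup H] [InnerProductSpace ℂ H]
    [NormedAddCommGroup H'] [InnerProductSpace ℂ H']
    (ι : H →ₗᵢ[ℂ] H') (U : H' →L[ℂ] H')
    (hUiso : ∀ x : H', ‖U x‖ = ‖x‖) (hUsurj : Function.Surjective U)
    (P : H' →L[ℂ] H')
    (hPsa : ∀ x y : H', (inner ℂ (P x) y : ℂ) = inner ℂ x (P y))
    (hPidem : ∀ x : H', P (P x) = P x)
    (t : ℕ) (N : ℕ) (ε : Fin N → ℝ) (hε : ∀ i, 0 ≤ ε i)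
    (x : Fin N → H) (hx : ∀ i, ‖x i‖ = 1)
    (hhalt : ∀ i, (∀ s < t, ‖P ((U ^ s) (ι (x i)))‖ ^ 2 ≤ ε i) ∧
      1 - ε i ≤ ‖P ((U ^ t) (ι (x i)))‖ ^ 2)
    (α : Fin N → ℂ) (hunit : ‖∑ i, α i • x i‖ = 1) :
    (∀ s < t, ‖P ((U ^ s) (ι (∑ i, α i • x i)))‖ ^ 2 ≤
        (∑ i, ‖α i‖ * Real.sqrt (ε i)) ^ 2) ∧
      1 - (∑ i, ‖α i‖ * Real.sqrt (ε i)) ^ 2 ≤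
        ‖P ((U ^ t) (ι (∑ i, α i • x i)))‖ ^ 2 := by
  have hpow : ∀ (n : ℕ) (y : H'), ‖(U ^ n) y‖ = ‖y‖ := by
    intro n y
    induction n with
    | zero => simp
    | succ k ih => rw [pow_succ', mul_apply_eq_comp, hUiso, ih]
  have hpyth (y : H) : ‖P ((U ^ t) (ι y))‖ ^ 2 +
      ‖(U ^ t) (ι y) - P ((U ^ t) (ι y))‖ ^ 2 = ‖y‖ ^ 2 := by
    rw [norm_sq_add_norm_sub_sq_of_symmetric_idempotent P hPsa hPidem, hpow, ι.norm_map]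
  refine ⟨fun s hs => ?_, ?_⟩
  · exact norm_sq_map_sum_smul_le
      ((P : H' →ₗ[ℂ] H') ∘ₗ ((U ^ s : H' →L[ℂ] H') : H' →ₗ[ℂ] H') ∘ₗ ι.toLinearMap)
      ε x (fun i => (hhalt i).1 s hs) α
  · have hbound : ‖(U ^ t) (ι (∑ i, α i • x i)) - P ((U ^ t) (ι (∑ i, α i • x i)))‖ ^ 2 ≤
        (∑ i, ‖α i‖ * Real.sqrt (ε i)) ^ 2 := by
      refine norm_sq_map_sum_smul_le
        ((LinearMap.id - (P : H' →ₗ[ℂ] H')) ∘ₗ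
          ((U ^ t : H' →L[ℂ] H') : H' →ₗ[ℂ] H') ∘ₗ ι.toLinearMap)
        ε x (fun i => ?_) α
      change ‖(U ^ t) (ι (x i)) - P ((U ^ t) (ι (x i)))‖ ^ 2 ≤ ε i
      have h := hpyth (x i)
      rw [hx i] at h
      linarith [(hhalt i).2]
    have h := hpyth (∑ i, α i • x i)
    rw [hunit] at h
    linarith
end

section
/- Inner product and dimension bound. Let H be an inner product space over ℂ, let N ≥ 2 be a natural number, and let ψ_1, …, ψ_N ∈ H be unit vectors such that |⟨ψ_i, ψ_j⟩| < 1/(N − 1) for every pair i ≠ j. Then the vectors ψ_1, …, ψ_N are linearly independent; in particular the dimension of H is at least N. -/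
/-- A family of vectors in an inner product space is linearly independent as soon as its Gram
matrix is strictly diagonally dominant. -/
theorem linearIndependent_of_sum_norm_inner_lt {𝕜 E ι : Type*} [RCLike 𝕜] [NormedAddCommGroup E]
    [InnerProductSpace 𝕜 E] [Fintype ι] [DecidableEq ι] {v : ι → E}
    (h : ∀ i, ∑ j ∈ Finset.univ.erase i, ‖inner 𝕜 (v i) (v j)‖ < ‖v i‖ ^ 2) :
    LinearIndependent 𝕜 v := by
  refine Matrix.linearIndependent_of_det_gram_ne_zero (𝕜 := 𝕜)
    (det_ne_zero_of_sum_row_lt_diag fun i => ?_)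
  simpa [Matrix.gram_apply, inner_self_eq_norm_sq_to_K] using h i

/-- **Inner product and dimension bound.** If `ψ_1, …, ψ_N` (with `N ≥ 2`) are unit
vectors in a complex inner product space with `|⟨ψ_i, ψ_j⟩| < 1/(N−1)` for all
`i ≠ j`, then they are linearly independent; in particular `dim H ≥ N`. -/
theorem inner_product_dimension_bound
    {H : Type*} [NormedAddCommGroup H] [InnerProductSpace ℂ H]
    (N : ℕ) (hN : 2 ≤ N) (ψ : Fin N → H) (hψ : ∀ i, ‖ψ i‖ = 1)
    (hinner : ∀ i j, i ≠ j → ‖(inner ℂ (ψ i) (ψ j) : ℂ)‖ < 1 / ((N : ℝ) - 1)) :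
    LinearIndependent ℂ ψ ∧ (N : Cardinal) ≤ Module.rank ℂ H := by
  have hN' : (0 : ℝ) < N - 1 := by
    have : (2 : ℝ) ≤ N := by exact_mod_cast hN
    linarith
  have hli : LinearIndependent ℂ ψ := linearIndependent_of_sum_norm_inner_lt fun i => by
    have hcard : (Finset.univ.erase i).card = N - 1 := by simp
    calc ∑ j ∈ Finset.univ.erase i, ‖inner ℂ (ψ i) (ψ j)‖
        < ∑ _j ∈ Finset.univ.erase i, 1 / ((N : ℝ) - 1) :=
          Finset.sum_lt_sum_of_nonempty (Finset.card_pos.mp (by omega))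
            fun j hj => hinner i j (Finset.ne_of_mem_erase hj).symm
      _ = ‖ψ i‖ ^ 2 := by
          rw [Finset.sum_const, hcard, nsmul_eq_mul, Nat.cast_sub (by omega), Nat.cast_one,
            mul_one_div_cancel hN'.ne', hψ, one_pow]
  exact ⟨hli, by simpa using hli.cardinal_lift_le_rank⟩
end

section
/- Stability of expectation values of effects. Let H be a complex inner product space and let R be a self-adjoint bounded linear operator on H with 0 ≤ R ≤ 1 (i.e. both R and 1 − R are positive operators). Then: (i) for all unit vectors ψ, φ ∈ H, |⟨ψ, Rψ⟩ − ⟨φ, Rφ⟩| ≤ √(1 − |⟨ψ, φ⟩|²) ≤ ‖ψ − φ‖; and (ii) for every nonzero v ∈ H, writing v⁰ := v/‖v‖, |⟨v, Rv⟩ − ⟨v⁰, Rv⁰⟩| ≤ |1 − ‖v‖²|. (In the paper, R arises as the operator representing the halting probability ⟨q_f|M_C^t(·)|q_f⟩ of a quantum Turing machine, i.e. the composition of the embedding of the input, t steps of unitary evolution, and the projection onto the halting control state.) -/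
section EffectExpectations

variable {H : Type*} [NormedAddCommGroup H] [InnerProductSpace ℂ H] {R : H →L[ℂ] H}

lemma ofReal_re_inner_self_apply
    (hsa : ∀ x y : H, (inner ℂ (R x) y : ℂ) = inner ℂ x (R y)) (x : H) :
    (((inner ℂ x (R x) : ℂ).re : ℝ) : ℂ) = inner ℂ x (R x) := by
  rw [← Complex.conj_eq_iff_re, inner_conj_symm, hsa]

/-- For an effect `R`, the difference of the expectation values in two unit vectors is
controlled by the real part of their overlap. -/
lemma sq_sub_re_inner_le_one_sub_sq_re_inner
    (hpos : ∀ x : H, 0 ≤ (inner ℂ x (R x) : ℂ).re)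
    (hle : ∀ x : H, (inner ℂ x (R x) : ℂ).re ≤ ‖x‖ ^ 2)
    {ψ φ : H} (hψ : ‖ψ‖ = 1) (hφ : ‖φ‖ = 1) :
    ((inner ℂ ψ (R ψ) : ℂ).re - (inner ℂ φ (R φ) : ℂ).re) ^ 2 ≤
      1 - (inner ℂ ψ φ : ℂ).re ^ 2 := by
  have expand : ∀ a b : ℝ,
      (inner ℂ ((a : ℂ) • ψ + (b : ℂ) • φ) (R ((a : ℂ) • ψ + (b : ℂ) • φ)) : ℂ).re =
        a ^ 2 * (inner ℂ ψ (R ψ) : ℂ).re + b ^ 2 * (inner ℂ φ (R φ) : ℂ).re +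
          a * b * ((inner ℂ ψ (R φ) : ℂ).re + (inner ℂ φ (R ψ) : ℂ).re) := by
    intro a b
    simp only [map_add, map_smul, inner_add_left, inner_add_right, inner_smul_left,
      inner_smul_right, Complex.conj_ofReal, Complex.add_re, Complex.re_ofReal_mul]
    ring
  have norm_expand : ∀ a b : ℝ, ‖(a : ℂ) • ψ + (b : ℂ) • φ‖ ^ 2 =
      a ^ 2 + b ^ 2 + 2 * (a * b * (inner ℂ ψ φ : ℂ).re) := by
    intro a b
    rw [norm_add_sq (𝕜 := ℂ)]
    simp only [norm_smul, hψ, hφ, inner_smul_left, inner_smul_right, Complex.conj_ofReal,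
      RCLike.re_eq_complex_re, Complex.re_ofReal_mul, Complex.norm_real, mul_one,
      Real.norm_eq_abs, sq_abs]
    ring
  have quadratic : ∀ t : ℝ, 0 ≤ (2 - 2 * (inner ℂ ψ φ : ℂ).re) * (t * t) +
      (-4 * ((inner ℂ ψ (R ψ) : ℂ).re - (inner ℂ φ (R φ) : ℂ).re)) * t +
      (2 + 2 * (inner ℂ ψ φ : ℂ).re) := by
    intro t
    have h₁ := hle (((1 + t : ℝ) : ℂ) • ψ + ((1 - t : ℝ) : ℂ) • φ)
    have h₂ := hpos (((1 - t : ℝ) : ℂ) • ψ + ((1 + t : ℝ) : ℂ) • φ)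
    rw [expand, norm_expand] at h₁
    rw [expand] at h₂
    linarith
  have h := discrim_le_zero quadratic
  rw [discrim] at h
  linarith

lemma norm_sub_inner_le_sqrt_one_sub_sq_norm_inner
    (hsa : ∀ x y : H, (inner ℂ (R x) y : ℂ) = inner ℂ x (R y))
    (hpos : ∀ x : H, 0 ≤ (inner ℂ x (R x) : ℂ).re)
    (hle : ∀ x : H, (inner ℂ x (R x) : ℂ).re ≤ ‖x‖ ^ 2)
    {ψ φ : H} (hψ : ‖ψ‖ = 1) (hφ : ‖φ‖ = 1) :
    ‖(inner ℂ ψ (R ψ) : ℂ) - inner ℂ φ (R φ)‖ ≤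
      Real.sqrt (1 - ‖(inner ℂ ψ φ : ℂ)‖ ^ 2) := by
  obtain ⟨z, hz, hzc⟩ := RCLike.exists_norm_eq_mul_self (inner ℂ ψ φ : ℂ)
  have h := sq_sub_re_inner_le_one_sub_sq_re_inner hpos hle hψ
    (φ := z • φ) (by rw [norm_smul, hz, hφ, one_mul])
  have phase : (inner ℂ (z • φ) (R (z • φ)) : ℂ) = inner ℂ φ (R φ) := by
    rw [map_smul, inner_smul_left, inner_smul_right, ← mul_assoc, RCLike.conj_mul, hz]
    simp
  have overlap : (inner ℂ ψ (z • φ) : ℂ).re = ‖(inner ℂ ψ φ : ℂ)‖ := by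
    rw [inner_smul_right, ← hzc]
    exact Complex.ofReal_re _
  rw [phase, overlap] at h
  rw [← ofReal_re_inner_self_apply hsa ψ, ← ofReal_re_inner_self_apply hsa φ,
    ← Complex.ofReal_sub, Complex.norm_real]
  exact Real.abs_le_sqrt h

end EffectExpectations

lemma sqrt_one_sub_sq_norm_inner_le_norm_sub
    {H : Type*} [NormedAddCommGroup H] [InnerProductSpace ℂ H]
    {ψ φ : H} (hψ : ‖ψ‖ = 1) (hφ : ‖φ‖ = 1) :
    Real.sqrt (1 - ‖(inner ℂ ψ φ : ℂ)‖ ^ 2) ≤ ‖ψ - φ‖ := by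
  refine Real.sqrt_le_iff.mpr ⟨norm_nonneg _, ?_⟩
  rw [norm_sub_sq (𝕜 := ℂ), hψ, hφ, RCLike.re_eq_complex_re]
  nlinarith [Complex.re_le_norm (inner ℂ ψ φ : ℂ), sq_nonneg (1 - ‖(inner ℂ ψ φ : ℂ)‖)]

/-- Normalising a vector changes the expectation value of an effect by at most the
deviation of its squared norm from one. -/
lemma norm_inner_sub_inner_normalize_le
    {H : Type*} [NormedAddCommGroup H] [InnerProductSpace ℂ H] {R : H →L[ℂ] H}
    (hsa : ∀ x y : H, (inner ℂ (R x) y : ℂ) = inner ℂ x (R y))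
    (hpos : ∀ x : H, 0 ≤ (inner ℂ x (R x) : ℂ).re)
    (hle : ∀ x : H, (inner ℂ x (R x) : ℂ).re ≤ ‖x‖ ^ 2) {v : H} (hv : v ≠ 0) :
    ‖(inner ℂ v (R v) : ℂ) -
      inner ℂ ((‖v‖⁻¹ : ℝ) • v) (R ((‖v‖⁻¹ : ℝ) • v))‖ ≤ |1 - ‖v‖ ^ 2| := by
  have hv' : 0 < ‖v‖ := norm_pos_iff.mpr hv
  have scale : (inner ℂ v (R v) : ℂ) - inner ℂ ((‖v‖⁻¹ : ℝ) • v) (R ((‖v‖⁻¹ : ℝ) • v)) =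
      (((‖v‖ ^ 2 - 1) * ((inner ℂ v (R v) : ℂ).re / ‖v‖ ^ 2) : ℝ) : ℂ) := by
    have hvc : (‖v‖ : ℂ) ≠ 0 := by exact_mod_cast hv'.ne'
    rw [RCLike.real_smul_eq_coe_smul (K := ℂ), map_smul, inner_smul_left, inner_smul_right,
      RCLike.conj_ofReal]
    push_cast
    rw [ofReal_re_inner_self_apply hsa]
    simp only [Complex.coe_algebraMap]
    field_simp
  rw [scale, Complex.norm_real, Real.norm_eq_abs, abs_mul, abs_sub_comm,
    abs_of_nonneg (div_nonneg (hpos v) (sq_nonneg _))]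
  exact mul_le_of_le_one_right (abs_nonneg _) (div_le_one_of_le₀ (hle v) (sq_nonneg _))

/-- **Stability of expectation values of effects.** Let `R` be a self-adjoint bounded
operator on a complex inner product space with `0 ≤ R ≤ 1` (i.e. `0 ≤ ⟨x, Rx⟩ ≤ ‖x‖²`
for all `x`). Then (i) for unit vectors `ψ, φ`,
`|⟨ψ, Rψ⟩ − ⟨φ, Rφ⟩| ≤ √(1 − |⟨ψ, φ⟩|²) ≤ ‖ψ − φ‖`, and (ii) for every nonzero `v`,
with `v⁰ := v/‖v‖`, `|⟨v, Rv⟩ − ⟨v⁰, Rv⁰⟩| ≤ |1 − ‖v‖²|`. -/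
theorem stability_of_effect_expectations
    {H : Type*} [NormedAddCommGroup H] [InnerProductSpace ℂ H]
    (R : H →L[ℂ] H)
    (hsa : ∀ x y : H, (inner ℂ (R x) y : ℂ) = inner ℂ x (R y))
    (hpos : ∀ x : H, 0 ≤ (inner ℂ x (R x) : ℂ).re)
    (hle : ∀ x : H, (inner ℂ x (R x) : ℂ).re ≤ ‖x‖ ^ 2) :
    (∀ ψ φ : H, ‖ψ‖ = 1 → ‖φ‖ = 1 →
      ‖(inner ℂ ψ (R ψ) : ℂ) - inner ℂ φ (R φ)‖ ≤ Real.sqrt (1 - ‖(inner ℂ ψ φ : ℂ)‖ ^ 2) ∧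
      Real.sqrt (1 - ‖(inner ℂ ψ φ : ℂ)‖ ^ 2) ≤ ‖ψ - φ‖) ∧
    (∀ v : H, v ≠ 0 →
      ‖(inner ℂ v (R v) : ℂ) -
          inner ℂ ((‖v‖⁻¹ : ℝ) • v) (R ((‖v‖⁻¹ : ℝ) • v))‖ ≤ |1 - ‖v‖ ^ 2|) := by
  exact ⟨fun _ _ hψ hφ ↦
      ⟨norm_sub_inner_le_sqrt_one_sub_sq_norm_inner hsa hpos hle hψ hφ,
        sqrt_one_sub_sq_norm_inner_le_norm_sub hψ hφ⟩,
    fun _ hv ↦ norm_inner_sub_inner_normalize_le hsa hpos hle hv⟩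
end
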